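/- Let A be copositive (A x^m ≥ 0 for all x ≥ 0) and let a belong to the interior of the dual cone Sol(A,0)^+ = { q ∈ ℝ^n : ⟨v,q⟩ ≥ 0 for all v ∈ Sol(A,0) }. Then the map Sol_A : b ↦ Sol(A,b) is locally upper-Hölder at a: there exist γ > 0, c > 0 and ε > 0 such that for every b ∈ ℝ^n with ‖b − a‖ < ε, Sol(A,b) ⊆ Sol(A,a) + γ‖b − a‖^c · B̄(0,1), where B̄(0,1) is the closed unit ball of ℝ^n and + denotes Minkowski sum. -/

import Mathlib

open Finset MeasureTheory Pointwise

/-- For a tensor `A` of order `k+1` and dimension `n` (entries `A i j` = `a_{i, j 0, …, j (k-1)}`),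
`tApply A x` is the vector `A x^{k}` with `i`-th component
`∑_{i_2,…,i_{k+1}} a_{i i_2 ⋯ i_{k+1}} x_{i_2} ⋯ x_{i_{k+1}}`. -/
noncomputable def tApply {n k : ℕ} (A : Fin n → (Fin k → Fin n) → ℝ) (x : Fin n → ℝ) :
    Fin n → ℝ :=
  fun i => ∑ j : Fin k → Fin n, A i j * ∏ l : Fin k, x (j l)

/-- The solution set of the tensor complementarity problem `TCP(A,a)`. -/
def Sol {n k : ℕ} (A : Fin n → (Fin k → Fin n) → ℝ) (a : Fin n → ℝ) : Set (Fin n → ℝ) :=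
  {x | (∀ i, 0 ≤ x i) ∧ (∀ i, 0 ≤ tApply A x i + a i) ∧ ∑ i, x i * (tApply A x i + a i) = 0}

/-- `A` is an R₀-tensor if `Sol(A,0) = {0}`. -/
def IsR0 {n k : ℕ} (A : Fin n → (Fin k → Fin n) → ℝ) : Prop := Sol A 0 = {0}

/-- Frobenius norm of a tensor. -/
noncomputable def tNorm {n k : ℕ} (A : Fin n → (Fin k → Fin n) → ℝ) : ℝ :=
  Real.sqrt (∑ i, ∑ j, (A i j) ^ 2)

/-- Euclidean norm of a vector in ℝⁿ. -/
noncomputable def eNorm {n : ℕ} (x : Fin n → ℝ) : ℝ := Real.sqrt (∑ i, (x i) ^ 2)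

section Coef

set_option linter.unusedSectionVars false

variable {K : Type*} [Field K] [LinearOrder K] [IsStrictOrderedRing K]

/-- infinitesimal relative to a convex subring -/
def IsSmall (O : Subring K) (y : K) : Prop := ∀ z ∈ O, |y * z| ≤ 1

lemma IsSmall.zero (O : Subring K) : IsSmall O 0 := by
  intro z _; simp

lemma IsSmall.add {O : Subring K} {x y : K} (hx : IsSmall O x) (hy : IsSmall O y) :
    IsSmall O (x + y) := by
  intro z hz
  have h2 : z + z ∈ O := O.add_mem hz hz
  have h1 := abs_le.1 (hx _ h2)
  have h3 := abs_le.1 (hy _ h2)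
  rw [abs_le]
  constructor <;> nlinarith

lemma IsSmall.mul {O : Subring K} {x y : K} (hx : IsSmall O x) (hy : y ∈ O) :
    IsSmall O (x * y) := by
  intro z hz
  rw [mul_assoc]
  exact hx _ (O.mul_mem hy hz)

lemma IsSmall.neg {O : Subring K} {x : K} (hx : IsSmall O x) : IsSmall O (-x) := by
  intro z hz
  rw [neg_mul, abs_neg]; exact hx z hz

lemma IsSmall.sub {O : Subring K} {x y : K} (hx : IsSmall O x) (hy : IsSmall O y) :
    IsSmall O (x - y) := by
  rw [sub_eq_add_neg]; exact hx.add hy.neg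

lemma IsSmall.mono {O : Subring K} {x y : K} (hx : IsSmall O x) (h : |y| ≤ |x|) :
    IsSmall O y := by
  intro z hz
  refine le_trans ?_ (hx z hz)
  rw [abs_mul, abs_mul]
  exact mul_le_mul_of_nonneg_right h (abs_nonneg z)

lemma IsSmall.mem {O : Subring K} (hO : ∀ x ∈ O, ∀ y, |y| ≤ |x| → y ∈ O) {x : K}
    (hx : IsSmall O x) : x ∈ O := by
  have := hx 1 O.one_mem
  exact hO 1 O.one_mem x (by simpa using this)

lemma inv_mem_of_not_small {O : Subring K} (hO : ∀ x ∈ O, ∀ y, |y| ≤ |x| → y ∈ O) {x : K}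
    (hx : ¬ IsSmall O x) : x⁻¹ ∈ O := by
  unfold IsSmall at hx
  push Not at hx
  obtain ⟨z, hz, h⟩ := hx
  refine hO z hz _ ?_
  have hx0 : x ≠ 0 := by rintro rfl; simp at h; linarith
  have : 0 < |x| := abs_pos.2 hx0
  rw [abs_inv, inv_le_iff_one_le_mul₀' this, ← abs_mul]
  exact h.le

lemma IsSmall.eq_zero {O : Subring K} {x : K} (hx : IsSmall O x) (h : x⁻¹ ∈ O) : x = 0 := by
  by_contra h0
  have := hx _ (O.add_mem h h)
  rw [mul_add, mul_inv_cancel₀ h0, abs_of_pos (by norm_num)] at this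
  norm_num at this

open Polynomial in
lemma hensel_aux {O : Subring K} (hO : ∀ x ∈ O, ∀ y, |y| ≤ |x| → y ∈ O)
    (ivt : ∀ (P : K[X]) (a b : K), P.eval a * P.eval b ≤ 0 →
      ∃ s, |s - a| ≤ |b - a| ∧ P.eval s = 0)
    (Q : O[X]) (t : O) (h0 : IsSmall O (Q.eval t : O)) (h1 : ¬ IsSmall O (Q.derivative.eval t : O)) :
    ∃ s : O, Q.eval s = 0 ∧ IsSmall O ((s : K) - t) := by
  set e : O := Q.eval t with he
  set u : O := Q.derivative.eval t with hu
  have hui : (u : K)⁻¹ ∈ O := inv_mem_of_not_small hO h1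
  have hu0 : (u : K) ≠ 0 := by
    intro h; rw [h] at h1; exact h1 (IsSmall.zero O)
  let v : O := ⟨(u : K)⁻¹, hui⟩
  let h : O := -2 * e * v
  obtain ⟨k, hk⟩ := Polynomial.binomExpansion Q t h
  have hsm : IsSmall O (h : K) := by
    have : (h : K) = (e : K) * ((-2 * v : O) : K) := by
      simp only [h]; push_cast; ring
    rw [this]; exact h0.mul (Subtype.property _)
  have hk' : ((Q.eval (t + h) : O) : K) = -e * (1 - e * ((4 * k * v * v : O) : K)) := by
    rw [hk, ← he, ← hu]
    have c2 : ((2 : O) : K) = 2 := rfl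
    have c4 : ((4 : O) : K) = 4 := rfl
    simp only [h, v]
    push_cast
    rw [c2, c4]
    field_simp
    ring
  have hle := abs_le.1 (h0 _ (4 * k * v * v : O).2)
  have hev : ∀ y : O, (Q.map O.subtype).eval (y : K) = ((Q.eval y : O) : K) := by
    intro y
    exact Polynomial.eval_map_apply (f := O.subtype) y
  obtain ⟨s, hs1, hs2⟩ := ivt (Q.map O.subtype) (t : K) ((t + h : O) : K) (by
    rw [hev, hev, hk', ← he]
    nlinarith [mul_self_nonneg (e : K)])
  have hss : IsSmall O (s - t) := hsm.mono (by simpa using hs1)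
  have hsO : s ∈ O := by
    have := O.add_mem (hss.mem hO) t.2
    simpa using this
  refine ⟨⟨s, hsO⟩, ?_, hss⟩
  have := hev ⟨s, hsO⟩
  rw [hs2] at this
  exact Subtype.ext this.symm

open Polynomial in
lemma exists_coef {O : Subring K} (hO : ∀ x ∈ O, ∀ y, |y| ≤ |x| → y ∈ O)
    (ivt : ∀ (P : K[X]) (a b : K), P.eval a * P.eval b ≤ 0 →
      ∃ s, |s - a| ≤ |b - a| ∧ P.eval s = 0)
    (F₀ : Subfield K) (hF₀ : ∀ x ∈ F₀, x ∈ O) :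
    ∃ F : Subfield K, F₀ ≤ F ∧ (∀ x ∈ F, x ∈ O) ∧ ∀ t ∈ O, ∃ f ∈ F, IsSmall O (t - f) := by
  obtain ⟨F, hF, hmax⟩ := zorn_le_nonempty₀ {F : Subfield K | ∀ x ∈ F, x ∈ O} (by
    intro c hc hch y hy
    refine ⟨sSup c, ?_, fun z hz => le_sSup hz⟩
    intro x hx
    rw [Subfield.mem_sSup_of_directedOn ⟨y, hy⟩ hch.directedOn] at hx
    obtain ⟨G, hG, hxG⟩ := hx
    exact hc hG x hxG) F₀ hF₀
  have hFO : ∀ x ∈ F, x ∈ O := hmax.prop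
  refine ⟨F, hF, hFO, ?_⟩
  -- key consequence of maximality
  have key : ∀ s : K, (∀ x ∈ IntermediateField.adjoin F {s}, x ∈ O) → s ∈ F := by
    intro s hs
    have h1 : F ≤ (IntermediateField.adjoin F {s}).toSubfield := by
      intro x hx
      exact (IntermediateField.adjoin F {s}).algebraMap_mem ⟨x, hx⟩
    have h2 := hmax.le_of_ge (y := (IntermediateField.adjoin F {s}).toSubfield) hs h1
    exact h2 (IntermediateField.mem_adjoin_simple_self F s)
  let ι : F →+* O := Subring.inclusion (S := F.toSubring) (T := O) hFO
  have hι : ∀ (p : F[X]) (y : O), (((p.map ι).eval y : O) : K) = aeval (y : K) p := by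
    intro p y
    have := (Polynomial.eval_map_apply (p := p.map ι) (f := O.subtype) y)
    rw [Polynomial.map_map] at this
    change _ = O.subtype _ at this
    rw [Polynomial.aeval_def, ← Polynomial.eval_map]
    exact this.symm
  intro t ht
  by_cases hp : ∃ p : F[X], p ≠ 0 ∧ IsSmall O (aeval t p)
  · classical
    have hex : ∃ d : ℕ, ∃ p : F[X], p ≠ 0 ∧ IsSmall O (aeval t p) ∧ p.natDegree = d := by
      obtain ⟨p, h1, h2⟩ := hp
      exact ⟨_, p, h1, h2, rfl⟩
    obtain ⟨p, hp0, hps, hpd⟩ := Nat.find_spec hex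
    have hdeg : p.natDegree ≠ 0 := by
      intro h
      obtain ⟨c, hc⟩ := Polynomial.natDegree_eq_zero.1 h
      rw [← hc, aeval_C] at hps
      have : (algebraMap F K c) = 0 := hps.eq_zero (hFO _ (F.inv_mem c.2))
      have hc0 : c = 0 := Subtype.ext this
      rw [hc0] at hc
      exact hp0 (by rw [← hc]; simp)
    have hder : ¬ IsSmall O (aeval t p.derivative) := by
      intro h
      have hlt : p.derivative.natDegree < Nat.find hex := by
        rw [← hpd]; exact Polynomial.natDegree_derivative_lt hdeg
      refine Nat.find_min hex hlt ⟨p.derivative, ?_, h, rfl⟩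
      intro h0
      exact hdeg (Polynomial.derivative_eq_zero.1 h0)
    obtain ⟨s, hs, hst⟩ := hensel_aux hO ivt (p.map ι) ⟨t, ht⟩ (by rw [hι]; exact hps)
      (by rw [Polynomial.derivative_map, hι]; exact hder)
    have hs' : aeval (s : K) p = 0 := by
      rw [← hι, hs]; rfl
    have hsF : (s : K) ∈ F := by
      apply key
      intro x hx
      have halg : IsAlgebraic F (s : K) := ⟨p, hp0, hs'⟩
      rw [← IntermediateField.mem_toSubalgebra,
        IntermediateField.adjoin_simple_toSubalgebra_of_isAlgebraic halg,
        Algebra.adjoin_singleton_eq_range_aeval] at hx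
      obtain ⟨q, rfl⟩ := hx
      change aeval (s : K) q ∈ O
      rw [← hι]
      exact Subtype.property _
    refine ⟨s, hsF, ?_⟩
    have := hst.neg
    simpa using this
  · push Not at hp
    refine ⟨t, key t ?_, by simpa using IsSmall.zero O⟩
    intro x hx
    rw [IntermediateField.mem_adjoin_simple_iff] at hx
    obtain ⟨r, q, rfl⟩ := hx
    rw [div_eq_mul_inv]
    refine O.mul_mem ?_ ?_
    · rw [← hι r ⟨t, ht⟩]; exact Subtype.property _
    · by_cases hq : q = 0
      · simp [hq]
      · exact inv_mem_of_not_small hO (hp q hq)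

open Polynomial in
lemma exists_tau {O : Subring K} (hO : ∀ x ∈ O, ∀ y, |y| ≤ |x| → y ∈ O)
    (ivt : ∀ (P : K[X]) (a b : K), P.eval a * P.eval b ≤ 0 →
      ∃ s, |s - a| ≤ |b - a| ∧ P.eval s = 0)
    (F₀ : Subfield K) (hF₀ : ∀ x ∈ F₀, x ∈ O) :
    ∃ τ : O →+* K, (∀ y : O, IsSmall O ((y : K) - τ y)) ∧ (∀ y : O, (y : K) ∈ F₀ → τ y = y) ∧
      (∀ y : O, IsSmall O (y : K) → τ y = 0) ∧ (∀ y : O, 0 ≤ (y : K) → 0 ≤ τ y) := by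
  obtain ⟨F, hF, hFO, hsurj⟩ := exists_coef hO ivt F₀ hF₀
  choose! f hf hfs using hsurj
  have uniq : ∀ x ∈ F, ∀ y ∈ F, ∀ t, IsSmall O (t - x) → IsSmall O (t - y) → x = y := by
    intro x hx y hy t h1 h2
    have h3 : IsSmall O (x - y) := by
      have := h2.sub h1
      simpa using this
    exact sub_eq_zero.1 (h3.eq_zero (hFO _ (F.inv_mem (F.sub_mem hx hy))))
  have fz : ∀ y ∈ O, y ∈ F → f y = y := fun y hy hyF =>
    uniq _ (hf y hy) _ hyF y (hfs y hy) (by simpa using IsSmall.zero O)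
  have fmul : ∀ x ∈ O, ∀ y ∈ O, f (x * y) = f x * f y := by
    intro x hx y hy
    refine uniq _ (hf _ (O.mul_mem hx hy)) _ (F.mul_mem (hf x hx) (hf y hy)) (x * y)
      (hfs _ (O.mul_mem hx hy)) ?_
    have h1 := ((hfs x hx).mul hy).add ((hfs y hy).mul (hFO _ (hf x hx)))
    have h2 : x * y - f x * f y = (x - f x) * y + (y - f y) * f x := by ring
    rw [h2]; exact h1
  let τ : O →+* K :=
    { toFun := fun y => f y
      map_one' := fz 1 O.one_mem F.one_mem
      map_zero' := fz 0 O.zero_mem F.zero_mem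
      map_mul' := fun x y => fmul x x.2 y y.2
      map_add' := by
        intro x y
        refine uniq _ (hf _ (O.add_mem x.2 y.2)) _ (F.add_mem (hf x x.2) (hf y y.2)) (x + y)
          (hfs _ (O.add_mem x.2 y.2)) ?_
        have h1 := (hfs x x.2).add (hfs y y.2)
        have h2 : (x + y : K) - (f x + f y) = (x - f x) + (y - f y) := by ring
        rw [h2]; exact h1 }
  refine ⟨τ, fun y => hfs y y.2, fun y hy => fz y y.2 (hF hy), ?_, ?_⟩
  · intro y hy
    exact uniq _ (hf y y.2) _ F.zero_mem y (hfs y y.2) (by simpa using hy)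
  · intro y hy
    obtain ⟨s, hs1, hs2⟩ := ivt (X ^ 2 - C (y : K)) 0 (1 + y) (by
      simp only [eval_sub, eval_pow, eval_X, eval_C]
      nlinarith [mul_nonneg hy hy, mul_nonneg hy (mul_nonneg hy hy)])
    have hsO : s ∈ O := hO (1 + y) (O.add_mem O.one_mem y.2) s (by simpa using hs1)
    have h2 : s * s = y := by
      simp only [eval_sub, eval_pow, eval_X, eval_C] at hs2
      linear_combination hs2
    change 0 ≤ f y
    rw [← h2, fmul s hsO s hsO]
    exact mul_self_nonneg _

end Coef

section Hyper

open Polynomial Filter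

abbrev HR : Type := Germ (hyperfilter ℕ : Filter ℕ) ℝ

lemma HR_eval (c : ℕ → ℕ → ℝ) (d : ℕ) (s : ℕ → ℝ) :
    (∑ i ∈ range d, ((c i : ℕ → ℝ) : HR) * (s : HR) ^ i) =
      ((fun N => ∑ i ∈ range d, c i N * s N ^ i : ℕ → ℝ) : HR) := by
  have := map_sum (Germ.coeRingHom (R := ℝ) (hyperfilter ℕ : Filter ℕ))
    (fun i => c i * s ^ i) (range d)
  simp only [map_mul, map_pow, Germ.coe_coeRingHom] at this
  rw [← this]
  congr 1
  ext N
  simp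

lemma HR_ivt (P : HR[X]) (a b : HR) (h : P.eval a * P.eval b ≤ 0) :
    ∃ s, |s - a| ≤ |b - a| ∧ P.eval s = 0 := by
  have hrep : ∀ x : HR, ∃ f : ℕ → ℝ, (f : HR) = x := fun x =>
    Germ.inductionOn x fun f => ⟨f, rfl⟩
  choose r hr using hrep
  set c : ℕ → ℕ → ℝ := fun i => r (P.coeff i) with hc
  have hev : ∀ s : ℕ → ℝ, P.eval (s : HR) =
      ((fun N => ∑ i ∈ range (P.natDegree + 1), c i N * s N ^ i : ℕ → ℝ) : HR) := by
    intro s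
    rw [Polynomial.eval_eq_sum_range, ← HR_eval]
    simp only [hc, hr]
  obtain ⟨a', rfl⟩ : ∃ f : ℕ → ℝ, (f : HR) = a := ⟨_, hr a⟩
  obtain ⟨b', rfl⟩ : ∃ f : ℕ → ℝ, (f : HR) = b := ⟨_, hr b⟩
  rw [hev, hev, ← Germ.coe_mul] at h
  have h' := Germ.coe_le.1 h
  have hpt : ∀ N : ℕ, ∃ s : ℝ, ((∑ i ∈ range (P.natDegree + 1), c i N * a' N ^ i) *
      (∑ i ∈ range (P.natDegree + 1), c i N * b' N ^ i) ≤ 0) →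
      |s - a' N| ≤ |b' N - a' N| ∧ ∑ i ∈ range (P.natDegree + 1), c i N * s ^ i = 0 := by
    intro N
    by_cases hN : ((∑ i ∈ range (P.natDegree + 1), c i N * a' N ^ i) *
      (∑ i ∈ range (P.natDegree + 1), c i N * b' N ^ i) ≤ 0)
    · have hcont : Continuous fun x : ℝ => ∑ i ∈ range (P.natDegree + 1), c i N * x ^ i := by
        fun_prop
      have := intermediate_value_uIcc (a := a' N) (b := b' N) hcont.continuousOn
      have h0 : (0 : ℝ) ∈ Set.uIcc (∑ i ∈ range (P.natDegree + 1), c i N * a' N ^ i)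
          (∑ i ∈ range (P.natDegree + 1), c i N * b' N ^ i) := by
        rw [Set.mem_uIcc]
        rcases mul_nonpos_iff.1 hN with h | h
        · right; exact ⟨h.2, h.1⟩
        · left; exact h
      obtain ⟨s, hs, hs0⟩ := this h0
      refine ⟨s, fun _ => ⟨?_, hs0⟩⟩
      exact Set.abs_sub_left_of_mem_uIcc hs
    · exact ⟨0, fun h => absurd h hN⟩
  choose s hs using hpt
  refine ⟨(s : HR), ?_, ?_⟩
  · rw [← Germ.coe_sub, ← Germ.coe_sub, Germ.abs_def, Germ.abs_def]
    refine Germ.coe_le.2 ?_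
    filter_upwards [h'] with N hN
    exact (hs N hN).1
  · rw [hev]
    refine Germ.coe_eq.2 ?_
    filter_upwards [h'] with N hN
    exact (hs N hN).2

end Hyper

section Main

open Filter

lemma tApply_map {n k : ℕ} (A : Fin n → (Fin k → Fin n) → ℝ) (x : ℕ → Fin n → ℝ) (i : Fin n)
    (φ : (ℕ → ℝ) →+* HR) :
    φ (fun N => tApply A (x N) i) =
      ∑ j : Fin k → Fin n, φ (fun _ => A i j) * ∏ l : Fin k, φ (fun N => x N (j l)) := by
  have : (fun N => tApply A (x N) i) =
      ∑ j : Fin k → Fin n, (fun _ : ℕ => A i j) * ∏ l : Fin k, (fun N => x N (j l)) := by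
    ext N
    simp [tApply]
  rw [this, map_sum]
  simp only [map_mul, map_prod]

lemma nonstd {n k : ℕ} (A : Fin n → (Fin k → Fin n) → ℝ) (a : Fin n → ℝ)
    (b x : ℕ → Fin n → ℝ) (δ : ℕ → ℝ) (R C : ℝ)
    (hδ0 : ∀ N, 0 < δ N) (hδ1 : ∀ N, δ N ≤ 1 / 2)
    (hb : ∀ N i, |b N i - a i| ≤ δ N ^ N) (hx : ∀ N i, |x N i| ≤ R)
    (hsol : ∀ N, x N ∈ Sol A (b N)) :
    ∃ N, ∃ z ∈ Sol A a, ∀ i, |x N i - z i| * C ≤ δ N := by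
  let φ : (ℕ → ℝ) →+* HR := Germ.coeRingHom (hyperfilter ℕ : Filter ℕ)
  have hφle : ∀ f g : ℕ → ℝ, φ f ≤ φ g ↔ ∀ᶠ N in (hyperfilter ℕ : Filter ℕ), f N ≤ g N :=
    fun f g => Germ.coe_le
  have hφeq : ∀ f g : ℕ → ℝ, φ f = φ g ↔ ∀ᶠ N in (hyperfilter ℕ : Filter ℕ), f N = g N :=
    fun f g => Germ.coe_eq
  have hφabs : ∀ f : ℕ → ℝ, |φ f| = φ (fun N => |f N|) := by
    intro f
    exact Germ.abs_def _
  have hφsurj : ∀ y : HR, ∃ f, φ f = y := fun x =>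
    Germ.inductionOn x fun f => ⟨f, rfl⟩
  let W : HR := φ (fun N => (δ N)⁻¹)
  have hW2 : 2 ≤ W := by
    have h2 : (2 : HR) = φ (fun _ => 2) := rfl
    rw [h2]
    refine (hφle _ _).2 (Eventually.of_forall fun N => ?_)
    rw [le_inv_comm₀ (by norm_num) (hδ0 N)]
    simpa using hδ1 N
  have hW1 : 1 ≤ W := by linarith [show (1 : HR) ≤ 2 by norm_num]
  have hWp : ∀ k : ℕ, 0 < W ^ k := fun k => pow_pos (by linarith [show (0 : HR) < 1 by norm_num]) k
  let O : Subring HR :=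
    { carrier := {y | ∃ k : ℕ, |y| ≤ W ^ k}
      one_mem' := ⟨0, by simp⟩
      zero_mem' := ⟨0, by simp⟩
      neg_mem' := by
        rintro y ⟨k, hk⟩
        exact ⟨k, by rwa [abs_neg]⟩
      mul_mem' := by
        rintro y z ⟨k, hk⟩ ⟨l, hl⟩
        refine ⟨k + l, ?_⟩
        rw [abs_mul, pow_add]
        exact mul_le_mul hk hl (abs_nonneg _) (hWp k).le
      add_mem' := by
        rintro y z ⟨k, hk⟩ ⟨l, hl⟩
        refine ⟨k + l + 1, ?_⟩
        have h1 : W ^ k ≤ W ^ (k + l) := pow_le_pow_right₀ hW1 (by omega)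
        have h2 : W ^ l ≤ W ^ (k + l) := pow_le_pow_right₀ hW1 (by omega)
        have h3 := abs_add_le y z
        have h4 : W ^ (k + l) * 2 ≤ W ^ (k + l) * W := mul_le_mul_of_nonneg_left hW2 (hWp _).le
        rw [pow_succ]
        linarith }
  have memO : ∀ y, y ∈ O ↔ ∃ k : ℕ, |y| ≤ W ^ k := fun y => Iff.rfl
  have hO : ∀ x ∈ O, ∀ y, |y| ≤ |x| → y ∈ O := by
    rintro x ⟨k, hk⟩ y hy
    exact ⟨k, hy.trans hk⟩
  have hWO : W ∈ O := ⟨1, by rw [abs_of_pos (by simpa using hWp 1), pow_one]⟩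
  have hbd : ∀ (f : ℕ → ℝ) (M : ℝ), (∀ N, |f N| ≤ M) → φ f ∈ O := by
    intro f M hM
    obtain ⟨k, hk⟩ := pow_unbounded_of_one_lt M (show (1 : ℝ) < 2 by norm_num)
    refine ⟨k, ?_⟩
    have h1 : |φ f| ≤ 2 ^ k := by
      have h2 : (2 ^ k : HR) = φ (fun _ => 2 ^ k) := rfl
      rw [hφabs, h2]
      exact (hφle _ _).2 (Eventually.of_forall fun N => (hM N).trans hk.le)
    exact h1.trans (pow_le_pow_left₀ (by norm_num) hW2 k)
  let F₀ : Subfield HR := (φ.comp (Pi.constRingHom ℕ ℝ)).fieldRange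
  have hcF : ∀ r : ℝ, φ (fun _ => r) ∈ F₀ := fun r => ⟨r, rfl⟩
  have hcO : ∀ r : ℝ, φ (fun _ => r) ∈ O := fun r => hbd _ |r| fun _ => le_rfl
  obtain ⟨τ, hτ1, hτ2, hτ3, hτ4⟩ := exists_tau hO HR_ivt F₀ (by
    rintro _ ⟨r, rfl⟩
    exact hcO r)
  let c : ℝ → O := fun r => ⟨φ (fun _ => r), hcO r⟩
  have hτc : ∀ r, τ (c r) = φ (fun _ => r) := fun r => hτ2 _ (hcF r)
  let X : Fin n → O := fun i => ⟨φ (fun N => x N i), hbd _ R fun N => hx N i⟩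
  have hbsm : ∀ i, IsSmall O (φ (fun N => b N i - a i)) := by
    rintro i z ⟨k, hk⟩
    have h1 : |φ (fun N => b N i - a i)| * W ^ k ≤ 1 := by
      rw [hφabs, ← map_pow, ← map_mul]
      have h2 : (1 : HR) = φ (fun _ => 1) := rfl
      rw [h2]
      refine (hφle _ _).2 ?_
      have hev : ∀ᶠ N in (hyperfilter ℕ : Filter ℕ), k ≤ N :=
        (Nat.hyperfilter_le_atTop (eventually_ge_atTop k))
      filter_upwards [hev] with N hN
      have h3 : |b N i - a i| ≤ δ N ^ k := (hb N i).trans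
        (pow_le_pow_of_le_one (hδ0 N).le (by linarith [hδ1 N]) hN)
      simp only [Pi.mul_apply, Pi.pow_apply]
      rw [inv_pow, ← div_eq_mul_inv, div_le_one (pow_pos (hδ0 N) k)]
      exact h3
    rw [abs_mul]
    exact (mul_le_mul_of_nonneg_left hk (abs_nonneg _)).trans h1
  let E : Fin n → O := fun i => ⟨φ (fun N => b N i - a i), (hbsm i).mem hO⟩
  let B : Fin n → O := fun i => c (a i) + E i
  have hB : ∀ i, (B i : HR) = φ (fun N => b N i) := by
    intro i
    change φ (fun _ => a i) + φ (fun N => b N i - a i) = _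
    rw [← map_add]
    congr 1
    ext N
    simp
  have hτB : ∀ i, τ (B i) = φ (fun _ => a i) := by
    intro i
    simp only [B]
    rw [map_add, hτc, hτ3 (E i) (hbsm i), add_zero]
  let T : Fin n → O := fun i => ∑ j : Fin k → Fin n, c (A i j) * ∏ l : Fin k, X (j l)
  have hT : ∀ i, (T i : HR) = φ (fun N => tApply A (x N) i) := by
    intro i
    rw [tApply_map]
    simp only [T]
    push_cast
    rfl
  choose zf hzf using fun i => hφsurj (τ (X i))
  let z : ℕ → Fin n → ℝ := fun N i => zf i N
  have hz : ∀ i, τ (X i) = φ (fun N => z N i) := fun i => (hzf i).symm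
  have hτT : ∀ i, τ (T i) = φ (fun N => tApply A (z N) i) := by
    intro i
    rw [tApply_map]
    simp only [T, map_sum, map_mul, map_prod, hτc, hz]
  have zero_eq : (0 : HR) = φ (fun _ => 0) := rfl
  have e1 : ∀ i, ∀ᶠ N in (hyperfilter ℕ : Filter ℕ), 0 ≤ z N i := by
    intro i
    rw [← hφle, ← zero_eq, ← hz]
    refine hτ4 _ ?_
    change 0 ≤ φ (fun N => x N i)
    rw [zero_eq, hφle]
    exact Eventually.of_forall fun N => (hsol N).1 i
  have e2 : ∀ i, ∀ᶠ N in (hyperfilter ℕ : Filter ℕ), 0 ≤ tApply A (z N) i + a i := by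
    intro i
    have h1 : 0 ≤ τ (T i + B i) := by
      refine hτ4 _ ?_
      push_cast
      rw [hT, hB, ← map_add, zero_eq, hφle]
      exact Eventually.of_forall fun N => (hsol N).2.1 i
    rw [map_add, hτT, hτB, ← map_add, zero_eq, hφle] at h1
    exact h1
  have e3 : ∀ᶠ N in (hyperfilter ℕ : Filter ℕ), ∑ i, z N i * (tApply A (z N) i + a i) = 0 := by
    have h1 : ∑ i, X i * (T i + B i) = 0 := by
      apply Subtype.ext
      push_cast
      have : ∀ i, (X i : HR) = φ (fun N => x N i) := fun i => rfl
      simp only [hT, hB, this, ← map_add, ← map_mul, ← map_sum]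
      rw [zero_eq, hφeq]
      refine Eventually.of_forall fun N => ?_
      have := (hsol N).2.2
      simpa using this
    have h2 := congrArg τ h1
    simp only [map_sum, map_mul, map_add, hτT, hτB, hz, map_zero] at h2
    simp only [← map_add, ← map_mul, ← map_sum] at h2
    rw [zero_eq, hφeq] at h2
    filter_upwards [h2] with N hN
    simpa using hN
  have e4 : ∀ i, ∀ᶠ N in (hyperfilter ℕ : Filter ℕ), |x N i - z N i| * C ≤ δ N := by
    intro i
    have h1 := hτ1 (X i) _ (O.mul_mem (hcO C) hWO)
    rw [hz] at h1
    change |(φ (fun N => x N i) - _) * _| ≤ _ at h1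
    simp only [W] at h1
    rw [← map_sub, ← map_mul, ← map_mul, hφabs, show (1 : HR) = φ (fun _ => 1) from rfl, hφle] at h1
    filter_upwards [h1] with N hN
    simp only [Pi.mul_apply, Pi.sub_apply] at hN
    have hd := hδ0 N
    rw [← mul_assoc, ← div_eq_mul_inv, abs_div, abs_of_pos hd, div_le_one hd, abs_mul] at hN
    exact (mul_le_mul_of_nonneg_left (le_abs_self C) (abs_nonneg _)).trans hN
  obtain ⟨N, h1, h2, h3, h4⟩ := ((eventually_all.2 e1).and ((eventually_all.2 e2).and
    (e3.and (eventually_all.2 e4)))).exists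
  exact ⟨N, z N, ⟨h1, h2, h3⟩, h4⟩

lemma tApply_smul {n k : ℕ} (A : Fin n → (Fin k → Fin n) → ℝ) (r : ℝ) (x : Fin n → ℝ) (i : Fin n) :
    tApply A (r • x) i = r ^ k * tApply A x i := by
  simp only [tApply, Pi.smul_apply, smul_eq_mul, Finset.prod_mul_distrib, Finset.mul_sum]
  refine Finset.sum_congr rfl fun j _ => ?_
  simp
  ring

lemma tApply_cont {n k : ℕ} (A : Fin n → (Fin k → Fin n) → ℝ) (i : Fin n) :
    Continuous fun x : Fin n → ℝ => tApply A x i := by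
  unfold tApply
  fun_prop

lemma bounded_aux {n k : ℕ} (hk : k ≠ 0) (A : Fin n → (Fin k → Fin n) → ℝ)
    (hcop : ∀ x : Fin n → ℝ, (∀ i, 0 ≤ x i) → 0 ≤ ∑ i, x i * tApply A x i)
    (a : Fin n → ℝ)
    (ha : a ∈ interior {q : Fin n → ℝ | ∀ v ∈ Sol A 0, 0 ≤ ∑ i, v i * q i}) :
    ∃ ε > (0 : ℝ), ∃ R : ℝ, ∀ b : Fin n → ℝ, ‖b - a‖ < ε → ∀ x ∈ Sol A b, ‖x‖ ≤ R := by
  by_contra hcon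
  push Not at hcon
  choose b hb x hx hxn using fun N : ℕ =>
    hcon (1 / ((N : ℝ) + 1)) Nat.one_div_pos_of_nat ((N : ℝ) + 1)
  have hpos : ∀ N, 0 < ‖x N‖ := fun N => lt_trans (by positivity) (hxn N)
  let v : ℕ → Fin n → ℝ := fun N => ‖x N‖⁻¹ • x N
  have hvn : ∀ N, v N ∈ Metric.sphere (0 : Fin n → ℝ) 1 := by
    intro N
    rw [mem_sphere_zero_iff_norm, norm_smul, norm_inv, norm_norm, inv_mul_cancel₀ (hpos N).ne']
  obtain ⟨w, hw, σ, hσ, hlim⟩ := (isCompact_sphere (0 : Fin n → ℝ) 1).tendsto_subseq hvn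
  have hblim : Tendsto b atTop (nhds a) := by
    rw [tendsto_iff_norm_sub_tendsto_zero]
    exact squeeze_zero (fun _ => norm_nonneg _) (fun N => (hb N).le)
      tendsto_one_div_add_atTop_nhds_zero_nat
  have hblim' := hblim.comp hσ.tendsto_atTop
  have hinv : Tendsto (fun N => ‖x N‖⁻¹) atTop (nhds 0) := by
    refine squeeze_zero (fun N => (inv_pos.2 (hpos N)).le) (fun N => ?_)
      tendsto_one_div_add_atTop_nhds_zero_nat
    rw [one_div]
    exact inv_anti₀ (by positivity) (hxn N).le
  have hinvk : Tendsto (fun N => ‖x (σ N)‖⁻¹ ^ k) atTop (nhds 0) := by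
    have := (hinv.comp hσ.tendsto_atTop).pow k
    rwa [zero_pow hk] at this
  have hxs := fun N => hx (σ N)
  have hvi : ∀ i, Tendsto (fun N => v (σ N) i) atTop (nhds (w i)) := fun i =>
    (tendsto_pi_nhds.1 hlim) i
  have hbi : ∀ i, Tendsto (fun N => b (σ N) i) atTop (nhds (a i)) := fun i =>
    (tendsto_pi_nhds.1 hblim') i
  have hTi : ∀ i, Tendsto (fun N => tApply A (v (σ N)) i) atTop (nhds (tApply A w i)) := fun i =>
    ((tApply_cont A i).tendsto w).comp hlim
  have hv0 : ∀ N i, 0 ≤ v N i := fun N i =>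
    mul_nonneg (inv_nonneg.2 (norm_nonneg _)) ((hx N).1 i)
  have hw0 : ∀ i, 0 ≤ w i := fun i => ge_of_tendsto' (hvi i) fun N => hv0 _ i
  have hscale : ∀ N i, tApply A (v N) i + ‖x N‖⁻¹ ^ k * b N i =
      ‖x N‖⁻¹ ^ k * (tApply A (x N) i + b N i) := by
    intro N i
    simp only [v]
    rw [tApply_smul]; ring
  have hwT : ∀ i, 0 ≤ tApply A w i := by
    intro i
    have h1 := (hTi i).add (hinvk.mul (hbi i))
    rw [zero_mul, add_zero] at h1
    refine ge_of_tendsto' h1 fun N => ?_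
    rw [hscale]
    exact mul_nonneg (by positivity) ((hxs N).2.1 i)
  have hsum : ∀ N, ∑ i, v N i * (tApply A (v N) i + ‖x N‖⁻¹ ^ k * b N i) = 0 := by
    intro N
    have h1 : ∀ i, v N i * (tApply A (v N) i + ‖x N‖⁻¹ ^ k * b N i) =
        (‖x N‖⁻¹ * ‖x N‖⁻¹ ^ k) * (x N i * (tApply A (x N) i + b N i)) := by
      intro i
      rw [hscale]
      simp only [v, Pi.smul_apply, smul_eq_mul]
      ring
    simp only [h1]
    rw [← Finset.mul_sum, (hx N).2.2, mul_zero]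
  have hwsum : ∑ i, w i * (tApply A w i) = 0 := by
    have h1 : Tendsto (fun N => ∑ i, v (σ N) i * (tApply A (v (σ N)) i + ‖x (σ N)‖⁻¹ ^ k * b (σ N) i))
        atTop (nhds (∑ i, w i * (tApply A w i + 0 * a i))) :=
      tendsto_finsetSum _ fun i _ => (hvi i).mul ((hTi i).add (hinvk.mul (hbi i)))
    simp only [hsum, zero_mul, add_zero] at h1
    exact (tendsto_nhds_unique h1 tendsto_const_nhds)
  have hwS : w ∈ Sol A 0 := ⟨hw0, by simpa using hwT, by simpa using hwsum⟩
  have hwa : ∑ i, w i * a i ≤ 0 := by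
    have h1 : Tendsto (fun N => ∑ i, v (σ N) i * b (σ N) i) atTop (nhds (∑ i, w i * a i)) :=
      tendsto_finsetSum _ fun i _ => (hvi i).mul (hbi i)
    refine le_of_tendsto' h1 fun N => ?_
    have h2 := hsum (σ N)
    have h3 := hcop (v (σ N)) (hv0 _)
    simp only [mul_add, Finset.sum_add_distrib] at h2
    have h4 : ∑ i, v (σ N) i * (‖x (σ N)‖⁻¹ ^ k * b (σ N) i) =
        ‖x (σ N)‖⁻¹ ^ k * ∑ i, v (σ N) i * b (σ N) i := by
      rw [Finset.mul_sum]
      exact Finset.sum_congr rfl fun i _ => by ring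
    rw [h4] at h2
    have h5 : 0 < ‖x (σ N)‖⁻¹ ^ k := pow_pos (inv_pos.2 (hpos _)) k
    by_contra h6
    push Not at h6
    have := mul_pos h5 h6
    linarith
  -- interior
  obtain ⟨r, hr, hball⟩ := Metric.mem_nhds_iff.1 (mem_interior_iff_mem_nhds.1 ha)
  have hwn : ‖w‖ = 1 := by simpa using hw
  have hmem : a - (r / 2) • w ∈ Metric.ball a r := by
    rw [mem_ball_iff_norm, sub_sub_cancel_left, norm_neg, norm_smul, hwn, Real.norm_eq_abs,
      abs_of_pos (by positivity)]
    linarith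
  have h7 := hball hmem w hwS
  have h8 : ∑ i, w i * (a - (r / 2) • w) i = ∑ i, w i * a i - (r / 2) * ∑ i, w i ^ 2 := by
    rw [Finset.mul_sum, ← Finset.sum_sub_distrib]
    refine Finset.sum_congr rfl fun i _ => ?_
    simp only [Pi.sub_apply, Pi.smul_apply, smul_eq_mul]
    ring
  rw [h8] at h7
  have h9 : ∑ i, w i ^ 2 ≤ 0 := by
    by_contra h
    push Not at h
    have := mul_pos (half_pos hr) h
    linarith
  have h10 : w = 0 := by
    have h11 : ∑ i, w i ^ 2 = 0 := le_antisymm h9 (Finset.sum_nonneg fun i _ => sq_nonneg _)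
    rw [Finset.sum_eq_zero_iff_of_nonneg (fun i _ => sq_nonneg _)] at h11
    ext i
    simpa using h11 i (Finset.mem_univ i)
  rw [h10] at hwn
  simp at hwn

lemma abs_le_eNorm {n : ℕ} (x : Fin n → ℝ) (i : Fin n) : |x i| ≤ eNorm x := by
  apply Real.abs_le_sqrt
  exact Finset.single_le_sum (f := fun i => x i ^ 2) (fun i _ => sq_nonneg _) (Finset.mem_univ i)

lemma norm_le_eNorm {n : ℕ} (x : Fin n → ℝ) : ‖x‖ ≤ eNorm x :=
  (pi_norm_le_iff_of_nonneg (Real.sqrt_nonneg _)).2 fun i => abs_le_eNorm x i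

lemma eNorm_le_of {n : ℕ} (x : Fin n → ℝ) (d : ℝ) (hd : 0 ≤ d) (h : ∀ i, |x i| * (n + 1) ≤ d) :
    eNorm x ≤ d := by
  rw [eNorm, Real.sqrt_le_left hd]
  have hn : (0 : ℝ) < (n : ℝ) + 1 := by positivity
  have h1 : ∀ i ∈ (Finset.univ : Finset (Fin n)), x i ^ 2 ≤ (d / (n + 1)) ^ 2 := by
    intro i _
    rw [← sq_abs]
    refine pow_le_pow_left₀ (abs_nonneg _) ?_ 2
    rw [le_div_iff₀ hn]; exact h i
  refine (Finset.sum_le_sum h1).trans ?_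
  simp only [Finset.sum_const, Finset.card_univ, Fintype.card_fin, nsmul_eq_mul]
  rw [div_pow, mul_div_assoc', div_le_iff₀ (by positivity)]
  have h0 : (0 : ℝ) ≤ n := Nat.cast_nonneg n
  nlinarith [sq_nonneg d, mul_nonneg h0 h0, mul_nonneg (sq_nonneg d) h0,
    mul_nonneg (sq_nonneg d) (mul_nonneg h0 h0)]

lemma eNorm_smul' {n : ℕ} (r : ℝ) (hr : 0 ≤ r) (x : Fin n → ℝ) : eNorm (r • x) = r * eNorm x := by
  simp only [eNorm, Pi.smul_apply, smul_eq_mul, mul_pow]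
  rw [← Finset.mul_sum, Real.sqrt_mul (sq_nonneg r), Real.sqrt_sq hr]

end Main

/-- if `A` is copositive and `a` lies in the interior of the dual cone of
`Sol(A,0)`, then `Sol_A` is locally upper-Hölder at `a`. -/
theorem stmt_18 (m n : ℕ) (hm : 2 ≤ m) (hn : 2 ≤ n) (A : Fin n → (Fin (m - 1) → Fin n) → ℝ)
    (hcop : ∀ x : Fin n → ℝ, (∀ i, 0 ≤ x i) → 0 ≤ ∑ i, x i * tApply A x i)
    (a : Fin n → ℝ)
    (ha : a ∈ interior {q : Fin n → ℝ | ∀ v ∈ Sol A 0, 0 ≤ ∑ i, v i * q i}) :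
    ∃ γ > (0 : ℝ), ∃ c > (0 : ℝ), ∃ ε > (0 : ℝ), ∀ b : Fin n → ℝ, eNorm (b - a) < ε →
      Sol A b ⊆ Sol A a +
        (γ * Real.rpow (eNorm (b - a)) c) • {x : Fin n → ℝ | eNorm x ≤ 1} := by
  by_contra hcon
  push Not at hcon
  obtain ⟨ε₀, hε₀, R, hR⟩ := bounded_aux (by omega) A hcop a ha
  choose b hb hns using fun N : ℕ =>
    hcon 1 one_pos (1 / ((N : ℝ) + 1)) Nat.one_div_pos_of_nat
      (min ε₀ ((1 / 2) ^ (N + 1))) (lt_min hε₀ (by positivity))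
  have hns' : ∀ N, ∃ x ∈ Sol A (b N), x ∉ Sol A a +
      ((1 : ℝ) * Real.rpow (eNorm (b N - a)) (1 / ((N : ℝ) + 1))) •
        {x : Fin n → ℝ | eNorm x ≤ 1} := fun N => Set.not_subset.1 (hns N)
  choose x hx hxn using hns'
  have ht0 : ∀ N, 0 ≤ eNorm (b N - a) := fun N => Real.sqrt_nonneg _
  have key : ∀ N, ∀ z ∈ Sol A a,
      eNorm (x N - z) ≤ Real.rpow (eNorm (b N - a)) (1 / ((N : ℝ) + 1)) →
      0 < Real.rpow (eNorm (b N - a)) (1 / ((N : ℝ) + 1)) → False := by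
    intro N z hz hle hpos
    apply hxn N
    set d := Real.rpow (eNorm (b N - a)) (1 / ((N : ℝ) + 1)) with hd
    refine Set.mem_add.2 ⟨z, hz, x N - z, ?_, by simp⟩
    rw [one_mul]
    refine Set.mem_smul_set.2 ⟨d⁻¹ • (x N - z), ?_, ?_⟩
    · change eNorm _ ≤ 1
      rw [eNorm_smul' _ (inv_nonneg.2 hpos.le), inv_mul_le_iff₀ hpos, mul_one]
      exact hle
    · rw [smul_smul, mul_inv_cancel₀ hpos.ne', one_smul]
  have htp : ∀ N, 0 < eNorm (b N - a) := by
    intro N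
    refine lt_of_le_of_ne (ht0 N) fun h => ?_
    have hba : b N = a := by
      ext i
      have := abs_le_eNorm (b N - a) i
      rw [← h] at this
      have h2 := abs_nonpos_iff.1 this
      exact sub_eq_zero.1 h2
    apply hxn N
    refine Set.mem_add.2 ⟨x N, by rw [← hba]; exact hx N, 0, ?_, by simp⟩
    refine Set.mem_smul_set.2 ⟨0, ?_, by simp⟩
    simp [eNorm]
  have hδpow : ∀ N : ℕ, Real.rpow (eNorm (b N - a)) (1 / ((N : ℝ) + 1)) ^ (N + 1) =
      eNorm (b N - a) := by
    intro N
    have := Real.rpow_inv_natCast_pow (ht0 N) (n := N + 1) (by omega)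
    rw [← one_div] at this
    push_cast at this
    exact this
  have hδ0 : ∀ N : ℕ, 0 < Real.rpow (eNorm (b N - a)) (1 / ((N : ℝ) + 1)) := fun N =>
    Real.rpow_pos_of_pos (htp N) _
  have hδ1 : ∀ N : ℕ, Real.rpow (eNorm (b N - a)) (1 / ((N : ℝ) + 1)) ≤ 1 / 2 := by
    intro N
    have h1 := (hb N).le.trans (min_le_right _ _)
    rw [← hδpow N] at h1
    exact le_of_pow_le_pow_left₀ (by omega) (by norm_num) h1
  obtain ⟨N, z, hz, hN⟩ := nonstd A a b x
    (fun N => Real.rpow (eNorm (b N - a)) (1 / ((N : ℝ) + 1))) R (n + 1) hδ0 hδ1 (by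
      intro N i
      refine (abs_le_eNorm (b N - a) i).trans ?_
      nth_rewrite 1 [← hδpow N]
      exact pow_le_pow_of_le_one (hδ0 N).le (by linarith [hδ1 N]) (Nat.le_succ N)) (by
      intro N i
      refine (norm_le_pi_norm (x N) i).trans ?_
      exact hR (b N) (lt_of_le_of_lt (norm_le_eNorm _) ((hb N).trans_le (min_le_left _ _)))
        (x N) (hx N)) hx
  exact key N z hz (eNorm_le_of _ _ (hδ0 N).le hN) (hδ0 N)
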